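/- arXiv:1705.07957 — 4 statements merged into one kernel-verified Lean document; each statement's English description precedes it below -/
import Mathlib

section
/- Let p be a positive integer, k an integer with 0 ≤ k < p, and c > 0. Let U be a real p×p orthogonal matrix (UᵀU = I_p), and let Σ = diag(μ₁, …, μ_p) with μ₁ ≥ μ₂ ≥ … ≥ μ_p ≥ 0. Set B = UΣUᵀ, and let Σ_k be the diagonal matrix whose first k diagonal entries are μ₁, …, μ_k and whose remaining entries are 0. Define H = B + cI_p and Ĥ = UΣ_kUᵀ + cI_p. Then both H and Ĥ are invertible and the operator (spectral) norm of I_p − Ĥ⁻¹H equals μ_{k+1}/c. -/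
open Matrix

open scoped Matrix.Norms.L2Operator in
/-- Orthogonal conjugation of a diagonal matrix has the sup norm of the diagonal as its
operator norm. -/
theorem norm_toEuclideanCLM_conj_diagonal {n : Type*} [Fintype n] [DecidableEq n]
    {U : Matrix n n ℝ} (hU : Uᵀ * U = 1) (d : n → ℝ) :
    ‖Matrix.toEuclideanCLM (𝕜 := ℝ) (n := n) (U * Matrix.diagonal d * Uᵀ)‖ = ‖d‖ := by
  have hmem : U ∈ unitary (Matrix n n ℝ) := by
    refine Unitary.mem_iff.2 ⟨?_, ?_⟩ <;>
      rw [Matrix.star_eq_conjTranspose, Matrix.conjTranspose_eq_transpose_of_trivial]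
    · exact hU
    · exact mul_eq_one_comm.1 hU
  rw [Matrix.l2_opNorm_toEuclideanCLM, ← Matrix.conjTranspose_eq_transpose_of_trivial,
    ← Matrix.star_eq_conjTranspose,
    CStarRing.norm_mul_mem_unitary _ (Unitary.star_mem hmem),
    CStarRing.norm_mem_unitary_mul _ hmem, Matrix.l2_opNorm_diagonal]

theorem conj_diagonal_add_smul_one {n : Type*} [Fintype n] [DecidableEq n]
    {U : Matrix n n ℝ} (hU : Uᵀ * U = 1) (d : n → ℝ) (c : ℝ) :
    U * Matrix.diagonal d * Uᵀ + c • (1 : Matrix n n ℝ) =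
      U * Matrix.diagonal (fun i => d i + c) * Uᵀ := by
  rw [← Matrix.diagonal_add, Matrix.mul_add, Matrix.add_mul, ← Matrix.smul_one_eq_diagonal,
    Matrix.mul_smul, Matrix.smul_mul, Matrix.mul_one, mul_eq_one_comm.1 hU]

theorem conj_diagonal_mul_conj_diagonal {n : Type*} [Fintype n] [DecidableEq n]
    {U : Matrix n n ℝ} (hU : Uᵀ * U = 1) (d e : n → ℝ) :
    U * Matrix.diagonal d * Uᵀ * (U * Matrix.diagonal e * Uᵀ) =
      U * Matrix.diagonal (fun i => d i * e i) * Uᵀ := by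
  rw [← Matrix.diagonal_mul_diagonal]
  simp only [Matrix.mul_assoc]
  rw [← Matrix.mul_assoc Uᵀ U, hU, Matrix.one_mul]

theorem conj_diagonal_mul_conj_diagonal_inv {n : Type*} [Fintype n] [DecidableEq n]
    {U : Matrix n n ℝ} (hU : Uᵀ * U = 1) {d : n → ℝ} (hd : ∀ i, d i ≠ 0) :
    U * Matrix.diagonal d * Uᵀ * (U * Matrix.diagonal (fun i => (d i)⁻¹) * Uᵀ) = 1 := by
  rw [conj_diagonal_mul_conj_diagonal hU]
  simp only [mul_inv_cancel₀ (hd _), Matrix.diagonal_one, Matrix.mul_one]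
  exact mul_eq_one_comm.1 hU

/-- The operator (spectral) norm of `I - Ĥ⁻¹ H`, where `H = U Σ Uᵀ + c I` is the
regularized Hessian and `Ĥ = U Σₖ Uᵀ + c I` its rank-`k` truncated approximation,
equals `μ_{k+1} / c` (here `μ ⟨k, _⟩` is the `(k+1)`-st largest eigenvalue,
`0`-indexed). -/
theorem kTAN_truncation_operator_norm
    (p k : ℕ) (hp : 0 < p) (hkp : k < p) (c : ℝ) (hc : 0 < c)
    (U : Matrix (Fin p) (Fin p) ℝ) (hU : Uᵀ * U = 1)
    (μ : Fin p → ℝ) (hmono : Antitone μ) (hnonneg : ∀ i, 0 ≤ μ i) :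
    let B := U * Matrix.diagonal μ * Uᵀ
    let Sk := Matrix.diagonal (fun i : Fin p => if (i : ℕ) < k then μ i else 0)
    let H := B + c • (1 : Matrix (Fin p) (Fin p) ℝ)
    let Hhat := U * Sk * Uᵀ + c • (1 : Matrix (Fin p) (Fin p) ℝ)
    IsUnit H ∧ IsUnit Hhat ∧
      ‖Matrix.toEuclideanCLM (𝕜 := ℝ) (n := Fin p) (1 - Hhat⁻¹ * H)‖ = μ ⟨k, hkp⟩ / c := by
  intro B Sk H Hhat
  set σ : Fin p → ℝ := fun i => if (i : ℕ) < k then μ i else 0 with hσ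
  have hσ_nonneg : ∀ i, 0 ≤ σ i := fun i => by
    simp only [hσ]
    split_ifs
    exacts [hnonneg i, le_rfl]
  have hH : H = U * Matrix.diagonal (fun i => μ i + c) * Uᵀ :=
    conj_diagonal_add_smul_one hU μ c
  have hHhat : Hhat = U * Matrix.diagonal (fun i => σ i + c) * Uᵀ :=
    conj_diagonal_add_smul_one hU σ c
  have hμ_ne : ∀ i, μ i + c ≠ 0 := fun i => (add_pos_of_nonneg_of_pos (hnonneg i) hc).ne'
  have hσ_ne : ∀ i, σ i + c ≠ 0 := fun i => (add_pos_of_nonneg_of_pos (hσ_nonneg i) hc).ne'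
  have hinv := conj_diagonal_mul_conj_diagonal_inv hU hσ_ne
  refine ⟨?_, ?_, ?_⟩
  · rw [hH]
    exact IsUnit.of_mul_eq_one _ (conj_diagonal_mul_conj_diagonal_inv hU hμ_ne)
  · rw [hHhat]
    exact IsUnit.of_mul_eq_one _ hinv
  have hdiff : 1 - Hhat⁻¹ * H =
      U * Matrix.diagonal (fun i : Fin p => if (i : ℕ) < k then 0 else -(μ i / c)) * Uᵀ := by
    rw [hHhat, hH, Matrix.inv_eq_right_inv hinv, conj_diagonal_mul_conj_diagonal hU]
    nth_rewrite 1 [← mul_eq_one_comm.1 hU]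
    nth_rewrite 1 [← Matrix.mul_one U]
    rw [← Matrix.sub_mul, ← Matrix.mul_sub, ← Matrix.diagonal_one, Matrix.diagonal_sub]
    congr 3
    funext i
    by_cases hi : (i : ℕ) < k
    · have := hμ_ne i
      simp [hσ, hi, this]
    · simp only [hσ, hi, if_false]
      field_simp
      ring
  rw [hdiff, norm_toEuclideanCLM_conj_diagonal hU]
  have hnn : ∀ i, 0 ≤ μ i / c := fun i => div_nonneg (hnonneg i) hc.le
  apply le_antisymm
  · refine (pi_norm_le_iff_of_nonneg (hnn _)).2 fun i => ?_
    split_ifs with hi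
    · simpa using hnn _
    · rw [norm_neg, Real.norm_of_nonneg (hnn i)]
      exact div_le_div_of_nonneg_right (hmono (Fin.le_def.2 (not_lt.1 hi))) hc.le
  · refine le_trans ?_ (norm_le_pi_norm _ (⟨k, hkp⟩ : Fin p))
    simp [abs_of_nonneg (hnonneg _), abs_of_pos hc]
end

section
/- (Lemma 1, k-TAN step error bound.) Let p be a positive integer, k an integer with 0 ≤ k < p, and c > 0. Let U be a real p×p orthogonal matrix (UᵀU = I_p), and let Σ = diag(μ₁, …, μ_p) with μ₁ ≥ μ₂ ≥ … ≥ μ_p ≥ 0. Set B = UΣUᵀ, let Σ_k be the diagonal matrix whose first k diagonal entries are μ₁, …, μ_k and whose remaining entries are 0, and define H = B + cI_p and Ĥ = UΣ_kUᵀ + cI_p. Then for every vector g ∈ ℝᵖ, ‖Ĥ⁻¹g − H⁻¹g‖ ≤ (μ_{k+1}/c) ‖H⁻¹g‖, where ‖·‖ is the Euclidean norm. -/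
open Matrix

/-- An orthogonal matrix preserves the Euclidean norm. -/
theorem norm_toEuclideanCLM_of_transpose_mul_self {n : Type*} [Fintype n] [DecidableEq n]
    {U : Matrix n n ℝ} (hU : Uᵀ * U = 1) (x : EuclideanSpace ℝ n) :
    ‖toEuclideanCLM (𝕜 := ℝ) (n := n) U x‖ = ‖x‖ := by
  have h : toEuclideanCLM (𝕜 := ℝ) (n := n) U ∈ unitary _ :=
    Unitary.map_mem (toEuclideanCLM (𝕜 := ℝ) (n := n)) <| by
      rw [mem_unitaryGroup_iff', star_eq_conjTranspose, conjTranspose_eq_transpose_of_trivial, hU]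
  exact ContinuousLinearMap.norm_map_of_mem_unitary h x

/-- Entrywise domination of diagonal matrices bounds their action in Euclidean norm. -/
theorem norm_toEuclideanCLM_diagonal_le {n : Type*} [Fintype n] [DecidableEq n]
    {a b : n → ℝ} {r : ℝ} (hr : 0 ≤ r) (hab : ∀ i, |a i| ≤ r * |b i|)
    (x : EuclideanSpace ℝ n) :
    ‖toEuclideanCLM (𝕜 := ℝ) (n := n) (diagonal a) x‖ ≤
      r * ‖toEuclideanCLM (𝕜 := ℝ) (n := n) (diagonal b) x‖ := by
  refine (sq_le_sq₀ (norm_nonneg _) (by positivity)).mp ?_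
  rw [mul_pow, EuclideanSpace.norm_sq_eq, EuclideanSpace.norm_sq_eq, Finset.mul_sum]
  refine Finset.sum_le_sum fun i _ => ?_
  simp only [ofLp_toEuclideanCLM, mulVec_diagonal, norm_mul, Real.norm_eq_abs]
  rw [← mul_pow, ← mul_assoc]
  gcongr
  exact hab i

/-- Inverse of a shifted matrix in an orthogonal eigenbasis. -/
theorem inv_conj_diagonal_add_smul_one {n : Type*} [Fintype n] [DecidableEq n]
    {U : Matrix n n ℝ} (hU : Uᵀ * U = 1) {d : n → ℝ} {c : ℝ} (hd : ∀ i, d i + c ≠ 0) :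
    (U * diagonal d * Uᵀ + c • (1 : Matrix n n ℝ))⁻¹ =
      U * diagonal (fun i => (d i + c)⁻¹) * Uᵀ := by
  have hU' : U * Uᵀ = 1 := mul_eq_one_comm.mp hU
  have hshift : U * diagonal d * Uᵀ + c • (1 : Matrix n n ℝ) =
      U * diagonal (fun i => d i + c) * Uᵀ := by
    rw [← diagonal_add, mul_add, add_mul, ← smul_one_eq_diagonal]
    simp [hU']
  apply inv_eq_right_inv
  calc _ = U * diagonal (fun i => d i + c) * (Uᵀ * U) *
        diagonal (fun i => (d i + c)⁻¹) * Uᵀ := by rw [hshift]; simp only [mul_assoc]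
    _ = 1 := by
      rw [hU, mul_one, mul_assoc U, diagonal_mul_diagonal]
      simp [hd, hU']

/-- Lemma 1 (k-TAN step error bound): the truncated Newton step `Ĥ⁻¹ g` differs
from the exact Newton step `H⁻¹ g` by at most `(μ_{k+1}/c) ‖H⁻¹ g‖` in Euclidean
norm, where `H = U Σ Uᵀ + c I` and `Ĥ = U Σₖ Uᵀ + c I`. -/
theorem kTAN_step_error_bound
    (p k : ℕ) (hp : 0 < p) (hkp : k < p) (c : ℝ) (hc : 0 < c)
    (U : Matrix (Fin p) (Fin p) ℝ) (hU : Uᵀ * U = 1)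
    (μ : Fin p → ℝ) (hmono : Antitone μ) (hnonneg : ∀ i, 0 ≤ μ i) :
    let B := U * Matrix.diagonal μ * Uᵀ
    let Sk := Matrix.diagonal (fun i : Fin p => if (i : ℕ) < k then μ i else 0)
    let H := B + c • (1 : Matrix (Fin p) (Fin p) ℝ)
    let Hhat := U * Sk * Uᵀ + c • (1 : Matrix (Fin p) (Fin p) ℝ)
    ∀ g : EuclideanSpace ℝ (Fin p),
      ‖Matrix.toEuclideanCLM (𝕜 := ℝ) (n := Fin p) Hhat⁻¹ g -
          Matrix.toEuclideanCLM (𝕜 := ℝ) (n := Fin p) H⁻¹ g‖ ≤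
        (μ ⟨k, hkp⟩ / c) * ‖Matrix.toEuclideanCLM (𝕜 := ℝ) (n := Fin p) H⁻¹ g‖ := by
  intro B Sk H Hhat g
  have hpos : ∀ i, 0 < μ i + c := fun i => add_pos_of_nonneg_of_pos (hnonneg i) hc
  have hH : H⁻¹ = U * diagonal (fun i => (μ i + c)⁻¹) * Uᵀ :=
    inv_conj_diagonal_add_smul_one hU fun i => (hpos i).ne'
  have hHhat : Hhat⁻¹ =
      U * diagonal (fun i : Fin p => ((if (i : ℕ) < k then μ i else 0) + c)⁻¹) * Uᵀ := by
    refine inv_conj_diagonal_add_smul_one hU fun i => ?_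
    split_ifs
    · exact (hpos i).ne'
    · simpa using hc.ne'
  rw [← _root_.sub_apply, ← map_sub, hH, hHhat, ← sub_mul, ← mul_sub, diagonal_sub]
  simp only [map_mul, mul_apply_eq_comp,
    norm_toEuclideanCLM_of_transpose_mul_self hU]
  refine norm_toEuclideanCLM_diagonal_le (div_nonneg (hnonneg _) hc.le) (fun i => ?_) _
  rw [abs_of_pos (inv_pos.mpr (hpos i))]
  split_ifs with hi
  · rw [sub_self, abs_zero]
    exact mul_nonneg (div_nonneg (hnonneg _) hc.le) (inv_pos.mpr (hpos i)).le
  · have hdiff : (0 + c)⁻¹ - (μ i + c)⁻¹ = μ i / c * (μ i + c)⁻¹ := by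
      have := (hpos i).ne'
      field_simp
      ring
    have hle : μ i ≤ μ ⟨k, hkp⟩ := hmono (Fin.mk_le_of_le_val (not_lt.mp hi))
    rw [hdiff, abs_of_nonneg (mul_nonneg (div_nonneg (hnonneg i) hc.le) (inv_pos.mpr (hpos i)).le)]
    have := (hpos i).le
    gcongr
end

section
/- (Theorem 1, algebraic core.) Let ε, ρ, λ, λ', S_m, S_n, K, V_m, V_n be real numbers satisfying: 0 ≤ ε ≤ ρ ≤ 1; 0 ≤ λ < 1/4; λ² ≤ 6 S_m; S_m ≤ K·V_m with K ≥ 0 and V_m ≥ 0; 0 ≤ λ' and λ' ≤ (4/(3 − ε)²)[(1 + ε)λ² + ελ]; S_n ≤ (λ')²; and (16/(3 − ρ)⁴)[36 K²(1 + ρ)² V_m² + 30 K^{3/2} ρ(1 + ρ) V_m^{3/2} + 6 K ρ² V_m] ≤ V_n. Then S_n ≤ V_n. -/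
/-- Theorem 1, algebraic core: under the quadratic-region and condition (10)
hypotheses, one k-TAN step solves `R_n` to within its statistical accuracy. -/
theorem kTAN_theorem_one_algebraic_core (ε ρ lam lam' Sm Sn K Vm Vn : ℝ)
    (hε0 : 0 ≤ ε) (hερ : ε ≤ ρ) (hρ1 : ρ ≤ 1)
    (hlam0 : 0 ≤ lam) (hlam : lam < 1 / 4)
    (hSm : lam ^ 2 ≤ 6 * Sm)
    (hK : 0 ≤ K) (hVm : 0 ≤ Vm) (hSmK : Sm ≤ K * Vm)
    (hlam'0 : 0 ≤ lam')
    (hlam' : lam' ≤ (4 / (3 - ε) ^ 2) * ((1 + ε) * lam ^ 2 + ε * lam))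
    (hSn : Sn ≤ lam' ^ 2)
    (hcond : (16 / (3 - ρ) ^ 4) *
        (36 * K ^ 2 * (1 + ρ) ^ 2 * Vm ^ 2 +
          30 * K ^ ((3 : ℝ) / 2) * ρ * (1 + ρ) * Vm ^ ((3 : ℝ) / 2) +
          6 * K * ρ ^ 2 * Vm) ≤ Vn) :
    Sn ≤ Vn := by
  have hx0 : 0 ≤ K * Vm := mul_nonneg hK hVm
  have hρ0 : 0 ≤ ρ := hε0.trans hερ
  have hlam2 : lam ^ 2 ≤ 6 * (K * Vm) := by linarith
  have hlam4 : lam ^ 4 ≤ 36 * (K * Vm) ^ 2 := by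
    calc lam ^ 4 = (lam ^ 2) ^ 2 := by ring
      _ ≤ (6 * (K * Vm)) ^ 2 := by gcongr
      _ = 36 * (K * Vm) ^ 2 := by ring
  have hlam3 : lam ^ 3 ≤ 15 * (K * Vm) ^ ((3 : ℝ) / 2) := by
    have hsq : ((K * Vm) ^ ((3 : ℝ) / 2)) ^ 2 = (K * Vm) ^ 3 := by
      rw [← Real.rpow_natCast, ← Real.rpow_mul hx0, ← Real.rpow_natCast]
      norm_num
    refine (pow_le_pow_iff_left₀ (by positivity) (by positivity) two_ne_zero).mp ?_
    calc (lam ^ 3) ^ 2 = (lam ^ 2) ^ 3 := by ring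
      _ ≤ (6 * (K * Vm)) ^ 3 := by gcongr
      _ ≤ 225 * (K * Vm) ^ 3 := by nlinarith [pow_nonneg hx0 3]
      _ = (15 * (K * Vm) ^ ((3 : ℝ) / 2)) ^ 2 := by rw [mul_pow 15, hsq]; norm_num
  have hstep : lam' ≤ (4 / (3 - ρ) ^ 2) * ((1 + ρ) * lam ^ 2 + ρ * lam) := by
    have hpos : 0 < 3 - ρ := by linarith
    refine hlam'.trans ?_
    gcongr
  have hexpand : ((4 / (3 - ρ) ^ 2) * ((1 + ρ) * lam ^ 2 + ρ * lam)) ^ 2 =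
      (16 / (3 - ρ) ^ 4) * ((1 + ρ) ^ 2 * lam ^ 4 +
        2 * ρ * (1 + ρ) * lam ^ 3 + ρ ^ 2 * lam ^ 2) := by
    rw [mul_pow, div_pow]
    ring
  calc Sn ≤ lam' ^ 2 := hSn
    _ ≤ ((4 / (3 - ρ) ^ 2) * ((1 + ρ) * lam ^ 2 + ρ * lam)) ^ 2 := by gcongr
    _ = (16 / (3 - ρ) ^ 4) * ((1 + ρ) ^ 2 * lam ^ 4 +
        2 * ρ * (1 + ρ) * lam ^ 3 + ρ ^ 2 * lam ^ 2) := hexpand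
    _ ≤ (16 / (3 - ρ) ^ 4) * ((1 + ρ) ^ 2 * (36 * (K * Vm) ^ 2) +
        2 * ρ * (1 + ρ) * (15 * (K * Vm) ^ ((3 : ℝ) / 2)) +
        ρ ^ 2 * (6 * (K * Vm))) := by gcongr
    _ ≤ Vn := by
      rw [Real.mul_rpow hK hVm]
      refine le_of_eq_of_le ?_ hcond
      ring
end

section
/- (Proposition 1, deterministic form.) Let E be a real inner product space, n = αm with α > 1 and m a positive integer, and let f₁, …, f_n : E → ℝ and L : E → ℝ be functions with L attaining its minimum at x* ∈ E. For a positive integer l ≤ n, let L_l(x) = (1/l)Σ_{i=1}^{l} f_i(x), and let L_{m,n}(x) = (1/(n−m))Σ_{i=m+1}^{n} f_i(x). Let c > 0 and V_m, V_n, V_{n−m} > 0 with V_m = αV_n and V_{n−m} ≤ V_m, and define R_l(x) = L_l(x) + (cV_l/2)‖x‖² for l ∈ {m, n}, with minimizers x_m* of R_m and x_n* of R_n. Assume the uniform statistical accuracy bounds: |L_m(x) − L(x)| ≤ V_m, |L_n(x) − L(x)| ≤ V_n, and |L_{m,n}(x) − L(x)| ≤ V_{n−m} for all x ∈ E. If x_m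 ∈ E satisfies R_m(x_m) − R_m(x_m*) ≤ V_m, then R_n(x_m) − R_n(x_n*) ≤ [3 + (2 + (c/2)‖x*‖²)(1 − 1/α)] V_m. -/
/-- The average over the first `n` terms is the convex combination, with weights `m / n` and
`1 - m / n`, of the averages over the first `m` terms and over the remaining ones. -/
theorem average_range_eq_convex_combination {m n : ℕ} (hm : 0 < m) (hmn : m < n) (g : ℕ → ℝ) :
    (1 / (n : ℝ)) * ∑ i ∈ Finset.range n, g i =
      (m / n : ℝ) * ((1 / (m : ℝ)) * ∑ i ∈ Finset.range m, g i) +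
        (1 - m / n : ℝ) * ((1 / ((n : ℝ) - m)) * ∑ i ∈ Finset.Ico m n, g i) := by
  have hm' : (m : ℝ) ≠ 0 := by positivity
  have hn' : (n : ℝ) ≠ 0 := Nat.cast_ne_zero.mpr (by omega)
  have hd : (n : ℝ) - m ≠ 0 := sub_ne_zero.mpr (by exact_mod_cast hmn.ne')
  rw [← Finset.sum_range_add_sum_Ico g hmn.le]
  field_simp

/-- Proposition 1 (deterministic form): if `x_m` solves `R_m` to within its
statistical accuracy `V_m`, then its suboptimality for the enlarged risk `R_n`
(with `n = αm`, `V_m = αV_n`) is at most `[3 + (2 + (c/2)‖x*‖²)(1 − 1/α)] V_m`. -/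
theorem adaptive_sample_size_suboptimality
    {E : Type*} [NormedAddCommGroup E] [InnerProductSpace ℝ E]
    (m n : ℕ) (hm : 0 < m) (α : ℝ) (hα : 1 < α) (hn : (n : ℝ) = α * m)
    (f : ℕ → E → ℝ) (L : E → ℝ)
    (xstar : E) (hxstar : ∀ x, L xstar ≤ L x)
    (c Vm Vn Vnm : ℝ) (hc : 0 < c) (hVm : 0 < Vm) (hVn : 0 < Vn) (hVnm : 0 < Vnm)
    (hVmn : Vm = α * Vn) (hVnm_le : Vnm ≤ Vm)
    (Lm Ln Lmn : E → ℝ)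
    (hLm : ∀ x, Lm x = (1 / (m : ℝ)) * ∑ i ∈ Finset.range m, f i x)
    (hLn : ∀ x, Ln x = (1 / (n : ℝ)) * ∑ i ∈ Finset.range n, f i x)
    (hLmn : ∀ x, Lmn x = (1 / ((n : ℝ) - m)) * ∑ i ∈ Finset.Ico m n, f i x)
    (Rm Rn : E → ℝ)
    (hRm : ∀ x, Rm x = Lm x + (c * Vm / 2) * ‖x‖ ^ 2)
    (hRn : ∀ x, Rn x = Ln x + (c * Vn / 2) * ‖x‖ ^ 2)
    (xm_star xn_star : E)
    (hxm_star : ∀ x, Rm xm_star ≤ Rm x)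
    (hxn_star : ∀ x, Rn xn_star ≤ Rn x)
    (hacc_m : ∀ x, |Lm x - L x| ≤ Vm)
    (hacc_n : ∀ x, |Ln x - L x| ≤ Vn)
    (hacc_mn : ∀ x, |Lmn x - L x| ≤ Vnm)
    (xm : E) (hxm : Rm xm - Rm xm_star ≤ Vm) :
    Rn xm - Rn xn_star ≤ (3 + (2 + (c / 2) * ‖xstar‖ ^ 2) * (1 - 1 / α)) * Vm := by
  have hm' : (0 : ℝ) < m := by exact_mod_cast hm
  have hmn : m < n := by
    have : (m : ℝ) < n := by rw [hn]; nlinarith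
    exact_mod_cast this
  obtain ⟨s, hs⟩ : ∃ s : ℝ, s = 1 / α := ⟨_, rfl⟩
  have hs0 : 0 < s := by rw [hs]; positivity
  have hs1 : s < 1 := by rw [hs, div_lt_one (by linarith)]; exact hα
  have hVn_eq : Vn = s * Vm := by rw [hs, hVmn]; field_simp
  have hratio : (m : ℝ) / n = s := by rw [hs, hn]; field_simp
  have hLn_eq : ∀ x, Ln x = s * Lm x + (1 - s) * Lmn x := fun x => by
    rw [hLn, hLm, hLmn, average_range_eq_convex_combination hm hmn (fun i => f i x), hratio]
  have hsm : ∀ x, |Lmn x - Lm x| ≤ 2 * Vm := fun x => by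
    have h₁ := abs_le.mp (hacc_m x)
    have h₂ := abs_le.mp (hacc_mn x)
    exact abs_le.mpr ⟨by linarith, by linarith⟩
  have hdiff : ∀ x, |Ln x - Lm x| ≤ 2 * (1 - s) * Vm := fun x => by
    rw [hLn_eq, show s * Lm x + (1 - s) * Lmn x - Lm x = (1 - s) * (Lmn x - Lm x) by ring,
      abs_mul, abs_of_pos (sub_pos.mpr hs1)]
    nlinarith [hsm x]
  have hdm := abs_le.mp (hdiff xm)
  have hdn := abs_le.mp (hdiff xn_star)
  have hmm := abs_le.mp (hacc_m xm)
  have hms := abs_le.mp (hacc_m xstar)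
  have hmn' := abs_le.mp (hacc_m xn_star)
  have hnm := abs_le.mp (hacc_n xm)
  have hns := abs_le.mp (hacc_n xstar)
  have hnn := abs_le.mp (hacc_n xn_star)
  have hLs := hxstar xn_star
  have hopt_n := hxn_star xstar
  have hmin_n := hxm_star xn_star
  have hmin_s := hxm_star xstar
  have hreg : 0 ≤ (1 - s) * Vm * (c / 2 * ‖xm‖ ^ 2) :=
    mul_nonneg (mul_nonneg (by linarith) hVm.le) (by positivity)
  simp only [hRm, hRn] at *
  rw [← hs]
  subst hVn_eq
  -- Comparing the two risks at `xn_star`.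
  have hA : (Ln xm + c * (s * Vm) / 2 * ‖xm‖ ^ 2) -
      (Ln xn_star + c * (s * Vm) / 2 * ‖xn_star‖ ^ 2) ≤
      Vm + (Ln xm - Lm xm) + (Lm xn_star - Ln xn_star) +
        (1 - s) * Vm * (c / 2 * ‖xn_star‖ ^ 2) := by linarith
  rcases le_total s (1 / 2) with h | h
  · -- For `s ≤ 1 / 2`, average with the comparison at `xstar`, so that `‖xn_star‖` cancels.
    have hB : (Ln xm + c * (s * Vm) / 2 * ‖xm‖ ^ 2) -
        (Ln xn_star + c * (s * Vm) / 2 * ‖xn_star‖ ^ 2) ≤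
        (3 + 2 * s) * Vm + Vm * (c / 2 * ‖xstar‖ ^ 2) -
          s * Vm * (c / 2 * ‖xn_star‖ ^ 2) := by linarith
    have hA' := hA.trans (show _ ≤ (3 + 2 * s) * Vm +
        (1 - s) * Vm * (c / 2 * ‖xn_star‖ ^ 2) by linarith)
    have hsA := mul_le_mul_of_nonneg_left hA' hs0.le
    have hsB := mul_le_mul_of_nonneg_left hB (sub_nonneg.mpr hs1.le)
    have := mul_le_mul_of_nonneg_right h hVm.le
    linarith
  · -- For `1 / 2 ≤ s`, optimality of `xn_star` bounds `‖xn_star‖`.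
    have hN : Vm * (c / 2 * ‖xn_star‖ ^ 2) ≤ 2 * Vm + Vm * (c / 2 * ‖xstar‖ ^ 2) :=
      le_of_mul_le_mul_left (by linarith) hs0
    have htN := mul_le_mul_of_nonneg_left hN (sub_nonneg.mpr hs1.le)
    have := mul_le_mul_of_nonneg_right h hVm.le
    linarith
end
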